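/- arXiv:2309.06570 — 2 statements merged into one kernel-verified Lean document; each statement's English description precedes it below -/
import Mathlib

section
/- Let n ≥ 1 and N = 2^n. For all natural numbers j, k < N, Σ_{x=0}^{N−1} (−1)^{e_n(x,j)} (−1)^{e_n(x,k)} = N if j = k and 0 if j ≠ k; that is, distinct columns of the (unnormalized) sequency-ordered Walsh–Hadamard matrix are orthogonal and each column has squared Euclidean norm N. -/
/-- The `i`-th binary digit of `s`, as a natural number in `{0,1}`. -/
def bit (s i : ℕ) : ℕ := (s.testBit i).toNat

/-- Bitwise dot product of `s` and `x` modulo 2: `s·x = Σ_i s_i x_i mod 2`.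
(All bits of `s` beyond position `s` vanish, so the range `s+1` covers all terms.) -/
def dot (s x : ℕ) : ℕ := (∑ i ∈ Finset.range (s + 1), bit s i * bit x i) % 2

/-- `Z_m(x) = (1/2) Σ_{k=0}^{2^m-2} |(-1)^{x·(k+1)} - (-1)^{x·k}|`, the number of sign
changes of the vector `((-1)^{x·k})_{k=0}^{2^m-1}`. -/
noncomputable def Z (m x : ℕ) : ℝ :=
  (1/2) * ∑ k ∈ Finset.range (2^m - 1), |(-1:ℝ)^(dot x (k+1)) - (-1:ℝ)^(dot x k)|

/-- The bit `g_k := s_0 ⊕ s_1 ⊕ ⋯ ⊕ s_{n-1-k}` (parity of the `n-k` least significant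
bits of `s`); in particular `g_{n-1} = s_0` and `g_n = 0`. -/
def gbit (n s k : ℕ) : ℕ := (∑ i ∈ Finset.range (n - k), bit s i) % 2

/-- `g(s) := Σ_{k=0}^{n-1} g_k 2^k`. -/
def gFun (n s : ℕ) : ℕ := ∑ k ∈ Finset.range n, gbit n s k * 2^k

/-- `e_n(k,j) := Σ_{r=0}^{n-1} k_{n-1-r} (j_r ⊕ j_{r+1}) mod 2`. -/
def eSeq (n k j : ℕ) : ℕ :=
  (∑ r ∈ Finset.range n, bit k (n-1-r) * ((bit j r + bit j (r+1)) % 2)) % 2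

/-- The sequency-ordered Walsh–Hadamard matrix `H^S_N`, `N = 2^n`, with
`(k,j)` entry `(1/√N)·(-1)^{e_n(k,j)}`. -/
noncomputable def HS (n : ℕ) : Matrix (Fin (2^n)) (Fin (2^n)) ℝ :=
  Matrix.of fun k j => (1 / Real.sqrt (2^n)) * (-1)^(eSeq n k j)

/-- The natural-ordered Walsh–Hadamard matrix `H_N`, `N = 2^n`, with
`(k,j)` entry `(1/√N)·(-1)^{k·j}`. -/
noncomputable def Hnat (n : ℕ) : Matrix (Fin (2^n)) (Fin (2^n)) ℝ :=
  Matrix.of fun k j => (1 / Real.sqrt (2^n)) * (-1)^(dot k j)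

lemma bit_le_one (s i : ℕ) : bit s i ≤ 1 := Bool.toNat_le _

lemma bit_eq_zero_of_lt_two_pow {s n i : ℕ} (hs : s < 2 ^ n) (hi : n ≤ i) : bit s i = 0 := by
  simp [bit, Nat.testBit_lt_two_pow (hs.trans_le (Nat.pow_le_pow_right two_pos hi))]

lemma eq_of_bit_eq {s t : ℕ} (h : ∀ i, bit s i = bit t i) : s = t :=
  Nat.eq_of_testBit_eq fun i =>
    (show Function.Injective Bool.toNat by decide) (h i)

/-- Summing a product over the binary digits of `x < 2^n` factors over the digits. -/
lemma sum_prod_pow_bit {R : Type*} [CommSemiring R] (c : ℕ → R) (n : ℕ) :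
    ∑ x ∈ Finset.range (2 ^ n), ∏ i ∈ Finset.range n, c i ^ bit x i =
      ∏ i ∈ Finset.range n, (1 + c i) := by
  induction n with
  | zero => simp
  | succ n ih =>
    rw [pow_succ, mul_two, Finset.sum_range_add, Finset.prod_range_succ, ← ih, mul_add, mul_one,
      Finset.sum_mul]
    congr 1
    · refine Finset.sum_congr rfl fun x hx => ?_
      rw [Finset.prod_range_succ, bit_eq_zero_of_lt_two_pow (Finset.mem_range.mp hx) le_rfl,
        pow_zero, mul_one]
    · refine Finset.sum_congr rfl fun x hx => ?_
      rw [Finset.prod_range_succ]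
      congr 1
      · refine Finset.prod_congr rfl fun i hi => ?_
        rw [bit, Nat.testBit_two_pow_add_gt (Finset.mem_range.mp hi), bit]
      · rw [bit, Nat.testBit_two_pow_add_eq, Nat.testBit_lt_two_pow (Finset.mem_range.mp hx)]
        simp

/-- The `r`-th digit `s_r ⊕ s_{r+1}` of the Gray code of `s`. -/
def grayBit (s r : ℕ) : ℕ := (bit s r + bit s (r + 1)) % 2

lemma eq_of_grayBit_eq {n j k : ℕ} (hj : j < 2 ^ n) (hk : k < 2 ^ n)
    (h : ∀ r < n, grayBit j r = grayBit k r) : j = k := by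
  have key : ∀ d ≤ n, bit j (n - d) = bit k (n - d) := by
    intro d
    induction d with
    | zero =>
      intro _
      rw [bit_eq_zero_of_lt_two_pow hj (by lia), bit_eq_zero_of_lt_two_pow hk (by lia)]
    | succ d ih =>
      intro hd
      have hg := h (n - (d + 1)) (by lia)
      have := ih (by lia)
      rw [grayBit, grayBit, show n - (d + 1) + 1 = n - d by lia] at hg
      have := bit_le_one j (n - (d + 1))
      have := bit_le_one k (n - (d + 1))
      lia
  refine eq_of_bit_eq fun i => ?_
  rcases le_or_gt n i with hi | hi
  · rw [bit_eq_zero_of_lt_two_pow hj hi, bit_eq_zero_of_lt_two_pow hk hi]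
  · simpa [Nat.sub_sub_self hi.le] using key (n - i) (by lia)

lemma neg_one_pow_eSeq {R : Type*} [CommRing R] (n x j : ℕ) :
    (-1 : R) ^ eSeq n x j =
      ∏ i ∈ Finset.range n, ((-1 : R) ^ grayBit j (n - 1 - i)) ^ bit x i := by
  rw [eSeq, ← neg_one_pow_eq_pow_mod_two, ← Finset.prod_pow_eq_pow_sum,
    ← Finset.prod_range_reflect]
  refine Finset.prod_congr rfl fun i hi => ?_
  have hi := Finset.mem_range.mp hi
  rw [show n - 1 - (n - 1 - i) = i by lia, mul_comm, pow_mul, grayBit]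

/-- for `n ≥ 1`, `N = 2^n` and `j, k < N`,
`Σ_{x=0}^{N-1} (-1)^{e_n(x,j)} (-1)^{e_n(x,k)}` equals `N` if `j = k` and `0`
otherwise: distinct columns of the unnormalized sequency-ordered Walsh–Hadamard
matrix are orthogonal, and each column has squared Euclidean norm `N`. -/
theorem stmt_11 (n : ℕ) (hn : 1 ≤ n) (j k : ℕ) (hj : j < 2^n) (hk : k < 2^n) :
    ∑ x ∈ Finset.range (2^n), (-1:ℝ)^(eSeq n x j) * (-1:ℝ)^(eSeq n x k) =
      if j = k then (2^n : ℝ) else 0 := by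
  simp_rw [neg_one_pow_eSeq, ← Finset.prod_mul_distrib, ← mul_pow]
  rw [sum_prod_pow_bit]
  split_ifs with h
  · subst h
    simp [← mul_pow, one_add_one_eq_two]
  · obtain ⟨r, hr, hne⟩ : ∃ r < n, grayBit j r ≠ grayBit k r := by
      by_contra! hall
      exact h (eq_of_grayBit_eq hj hk hall)
    refine Finset.prod_eq_zero (i := n - 1 - r) (Finset.mem_range.mpr (by lia)) ?_
    rw [show n - 1 - (n - 1 - r) = r by lia, ← pow_add, Odd.neg_one_pow, add_neg_cancel]
    rw [Nat.odd_iff]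
    unfold grayBit at hne ⊢
    lia
end

section
/- Let n ≥ 1, N = 2^n, and let k < N be a natural number. The k-th column of the sequency-ordered Walsh–Hadamard matrix has exactly k sign changes: (1/2) Σ_{x=0}^{N−2} |(−1)^{e_n(x+1,k)} − (−1)^{e_n(x,k)}| = k. -/
theorem bit_lt_two (s i : ℕ) : bit s i < 2 := Bool.toNat_lt _

theorem bit_half (s i : ℕ) : bit (s / 2) i = bit s (i + 1) := by
  simp [bit, Nat.testBit_succ]

theorem bit_eq_zero_of_lt {s i : ℕ} (h : s < 2 ^ i) : bit s i = 0 := by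
  simp [bit, Nat.testBit_lt_two_pow h]

theorem eSeq_zero_left (n k : ℕ) : eSeq n 0 k = 0 := by
  simp [eSeq, bit]

theorem eSeq_succ (n x k : ℕ) :
    eSeq (n + 1) x k = (eSeq n x (k / 2) + bit x n * (bit k 0 + bit k 1)) % 2 := by
  have h : ∀ r ∈ Finset.range n,
      bit x (n + 1 - 1 - (r + 1)) * ((bit k (r + 1) + bit k (r + 1 + 1)) % 2) =
        bit x (n - 1 - r) * ((bit (k / 2) r + bit (k / 2) (r + 1)) % 2) := by
    intro r _
    rw [bit_half, bit_half, show n + 1 - 1 - (r + 1) = n - 1 - r by omega]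
  rw [eSeq, eSeq, Finset.sum_range_succ', Finset.sum_congr rfl h]
  simp [Nat.add_mod, Nat.mul_mod]

theorem eSeq_succ_of_lt {n x : ℕ} (hx : x < 2 ^ n) (k : ℕ) :
    eSeq (n + 1) x k = eSeq n x (k / 2) := by
  rw [eSeq_succ, bit_eq_zero_of_lt hx]
  simp [eSeq]

theorem eSeq_two_pow_add {n x : ℕ} (hx : x < 2 ^ n) (k : ℕ) :
    eSeq (n + 1) (2 ^ n + x) k = (eSeq n x (k / 2) + (bit k 0 + bit k 1)) % 2 := by
  have h1 : bit (2 ^ n + x) n = 1 := by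
    simp [bit, Nat.testBit_two_pow_add_eq, Nat.testBit_lt_two_pow hx]
  have h2 : eSeq n (2 ^ n + x) (k / 2) = eSeq n x (k / 2) := by
    unfold eSeq
    congr 1
    refine Finset.sum_congr rfl fun r hr => ?_
    have hr' := Finset.mem_range.mp hr
    rw [bit, Nat.testBit_two_pow_add_gt (by omega), ← bit]
  rw [eSeq_succ, h1, h2, one_mul]

theorem eSeq_two_pow_sub_one (n k : ℕ) :
    eSeq n (2 ^ n - 1) k = (bit k 0 + bit k n) % 2 := by
  induction n generalizing k with
  | zero => simp [eSeq]; omega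
  | succ n ih =>
    have hp : 0 < 2 ^ n := by positivity
    rw [show 2 ^ (n + 1) - 1 = 2 ^ n + (2 ^ n - 1) by rw [pow_succ]; omega,
      eSeq_two_pow_add (by omega), ih, bit_half, bit_half, zero_add]
    omega

/-- The number of sign changes of column `k` doubles, up to the lowest bit of `k`, when passing
from `k / 2` and `n` to `k` and `n + 1`: the column is two signed copies of the shorter one. -/
theorem sum_abs_sub_eSeq_succ {n k : ℕ} (hk : k < 2 ^ (n + 1)) :
    ∑ x ∈ Finset.range (2 ^ (n + 1) - 1),
        |(-1 : ℝ) ^ eSeq (n + 1) (x + 1) k - (-1 : ℝ) ^ eSeq (n + 1) x k| =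
      2 * ∑ x ∈ Finset.range (2 ^ n - 1),
        |(-1 : ℝ) ^ eSeq n (x + 1) (k / 2) - (-1 : ℝ) ^ eSeq n x (k / 2)| + 2 * bit k 0 := by
  have hp : 0 < 2 ^ n := by positivity
  rw [show 2 ^ (n + 1) - 1 = (2 ^ n - 1 + 1) + (2 ^ n - 1) by rw [pow_succ]; omega,
    Finset.sum_range_add, Finset.sum_range_succ, Nat.sub_add_cancel hp]
  have left : ∀ x ∈ Finset.range (2 ^ n - 1),
      |(-1 : ℝ) ^ eSeq (n + 1) (x + 1) k - (-1 : ℝ) ^ eSeq (n + 1) x k| =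
        |(-1 : ℝ) ^ eSeq n (x + 1) (k / 2) - (-1 : ℝ) ^ eSeq n x (k / 2)| := by
    intro x hx
    have := Finset.mem_range.mp hx
    rw [eSeq_succ_of_lt (by omega), eSeq_succ_of_lt (by omega)]
  have right : ∀ x ∈ Finset.range (2 ^ n - 1),
      |(-1 : ℝ) ^ eSeq (n + 1) (2 ^ n + x + 1) k - (-1 : ℝ) ^ eSeq (n + 1) (2 ^ n + x) k| =
        |(-1 : ℝ) ^ eSeq n (x + 1) (k / 2) - (-1 : ℝ) ^ eSeq n x (k / 2)| := by
    intro x hx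
    have := Finset.mem_range.mp hx
    rw [add_assoc, eSeq_two_pow_add (by omega), eSeq_two_pow_add (by omega),
      ← neg_one_pow_eq_pow_mod_two, ← neg_one_pow_eq_pow_mod_two,
      pow_add _ (eSeq n (x + 1) _), pow_add _ (eSeq n x _), ← sub_mul, abs_mul, abs_neg_one_pow, mul_one]
  have middle :
      |(-1 : ℝ) ^ eSeq (n + 1) (2 ^ n) k - (-1 : ℝ) ^ eSeq (n + 1) (2 ^ n - 1) k| =
        2 * bit k 0 := by
    have h : eSeq (n + 1) (2 ^ n) k = (bit k 0 + bit k 1) % 2 := by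
      simpa [eSeq_zero_left] using eSeq_two_pow_add hp k
    rw [h, eSeq_succ_of_lt (by omega), eSeq_two_pow_sub_one,
      bit_eq_zero_of_lt (s := k / 2) (i := n) (by rw [pow_succ] at hk; omega), bit_half]
    have h0 := bit_lt_two k 0
    have h1 := bit_lt_two k 1
    rw [zero_add]
    interval_cases bit k 0 <;> interval_cases bit k 1 <;> norm_num
  rw [Finset.sum_congr rfl left, Finset.sum_congr rfl right, middle]
  ring

/-- for `n ≥ 1`, `N = 2^n` and `k < N`, the `k`-th column of the
sequency-ordered Walsh–Hadamard matrix has exactly `k` sign changes: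
`(1/2) Σ_{x=0}^{N-2} |(-1)^{e_n(x+1,k)} - (-1)^{e_n(x,k)}| = k`. -/
theorem stmt_13 (n : ℕ) (hn : 1 ≤ n) (k : ℕ) (hk : k < 2^n) :
    (1/2 : ℝ) * ∑ x ∈ Finset.range (2^n - 1),
        |(-1:ℝ)^(eSeq n (x+1) k) - (-1:ℝ)^(eSeq n x k)| = (k : ℝ) := by
  clear hn
  induction n generalizing k with
  | zero => simp_all
  | succ n ih =>
    have hhalf := ih (k / 2) (by rw [pow_succ] at hk; omega)
    have hbit : bit k 0 = k % 2 := by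
      rw [bit, Nat.testBit_zero]
      rcases Nat.mod_two_eq_zero_or_one k with h | h <;> simp [h]
    have hk2 : (k : ℝ) = 2 * (k / 2 : ℕ) + bit k 0 := by
      rw [hbit]
      exact_mod_cast (Nat.div_add_mod k 2).symm
    rw [sum_abs_sub_eSeq_succ hk, hk2, ← hhalf]
    ring
end
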